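/- arXiv:2402.19472 — 3 statements merged into one kernel-verified Lean document; each statement's English description precedes it below -/
import Mathlib

section
/- For every n ≥ 1 and every binary ground-truth vector a ∈ {0,1}^n, there exists a binary prediction vector y ∈ {0,1}^n with the same number of ones, |y| = |a| (so the aggregate-accuracy error E_agg(y,a) = ||y| − |a||/n equals 0), whose Hamming distance from a satisfies ‖a − y‖₁ = 2·min(|a|, n − |a|) (equivalently, the sample-level mean absolute error E(a,y) = ‖a − y‖₁/n equals 2·min(1 − |a|/n, |a|/n)). -/
/-- A vector `a ∈ {0,1}^n` is binary if every entry is `0` or `1`. -/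
def isBinary {n : ℕ} (a : Fin n → ℕ) : Prop := ∀ i, a i ≤ 1

/-- `|a|`: the number of ones of a binary vector. -/
def ones {n : ℕ} (a : Fin n → ℕ) : ℕ := ∑ i, a i

/-- `‖a − y‖₁`: the Hamming distance between vectors. -/
def hamming {n : ℕ} (a y : Fin n → ℕ) : ℕ := ∑ i, ((a i : ℤ) - (y i : ℤ)).natAbs

/-- The threshold vector `y^k`: ones in the first `k` positions, zeros after. -/
def thresh (n k : ℕ) : Fin n → ℕ := fun i => if (i : ℕ) < k then 1 else 0

/-- `e(k) = ‖a − y^k‖₁`: the error of the threshold vector `y^k` against `a`. -/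
def err {n : ℕ} (a : Fin n → ℕ) (k : ℕ) : ℕ := hamming a (thresh n k)

/-- `∑_{i=1}^k a_i`: the prefix sum of the first `k` entries. -/
def prefixSum {n : ℕ} (a : Fin n → ℕ) (k : ℕ) : ℕ :=
  ∑ i ∈ Finset.univ.filter (fun i : Fin n => (i : ℕ) < k), a i

/-- `∑_{i=k+1}^n a_i`: the sum of entries strictly to the right of index `k`. -/
def suffixSum {n : ℕ} (a : Fin n → ℕ) (k : ℕ) : ℕ :=
  ∑ i ∈ Finset.univ.filter (fun i : Fin n => k ≤ (i : ℕ)), a i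

/-- Signed prefix sums `c_k = ∑_{j=1}^k (2 a_j − 1)`, with `c_0 = 0`. -/
def signedPrefix {n : ℕ} (a : Fin n → ℕ) (k : ℕ) : ℤ :=
  ∑ i ∈ Finset.univ.filter (fun i : Fin n => (i : ℕ) < k), (2 * (a i : ℤ) - 1)

/-- An index `i ∈ {0,…,n}` is balanced if `2·∑_{k=i+1}^n a_k ≤ n − i`. -/
def BalancedIdx {n : ℕ} (a : Fin n → ℕ) (i : ℕ) : Prop := 2 * suffixSum a i ≤ n - i

/-- A vector is ordered (ones-then-zeros) if `y_j = 1` implies `y_{j'} = 1` for all `j' ≤ j`. -/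
def OnesThenZeros {n : ℕ} (y : Fin n → ℕ) : Prop :=
  ∀ j j' : Fin n, y j = 1 → j' ≤ j → y j' = 1

/-- For every `n ≥ 1` and binary `a ∈ {0,1}^n` there is a binary `y` with `|y| = |a|`
(so `E_agg(y,a) = 0`) and `‖a − y‖₁ = 2·min(|a|, n − |a|)`. -/
theorem stmt0 (n : ℕ) (hn : 1 ≤ n) (a : Fin n → ℕ) (ha : isBinary a) :
    ∃ y : Fin n → ℕ, isBinary y ∧ ones y = ones a ∧
      hamming a y = 2 * min (ones a) (n - ones a) := by
  classical
  set S := Finset.univ.filter (fun i : Fin n => a i = 1) with hS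
  have hcard : ones a = S.card := by
    rw [hS, Finset.card_filter, ones]
    refine Finset.sum_congr rfl fun i _ => ?_
    have := ha i
    split_ifs <;> omega
  have hT : Sᶜ.card = n - ones a := by
    rw [Finset.card_compl, hcard, Fintype.card_fin]
  obtain ⟨U, hU, hUc⟩ := Finset.exists_subset_card_eq
    (show min (ones a) (n - ones a) ≤ S.card by rw [← hcard]; exact min_le_left _ _)
  obtain ⟨V, hV, hVc⟩ := Finset.exists_subset_card_eq
    (show min (ones a) (n - ones a) ≤ Sᶜ.card by rw [hT]; exact min_le_right _ _)
  have hU1 : ∀ i ∈ U, a i = 1 := fun i hi => by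
    have := hU hi
    simpa [hS] using this
  have hV0 : ∀ i ∈ V, a i = 0 := fun i hi => by
    have h1 := hV hi
    have h2 := ha i
    have h3 : a i ≠ 1 := by simpa [hS] using h1
    omega
  have sumInd : ∀ W : Finset (Fin n), ∑ i, (if i ∈ W then 1 else 0) = W.card := fun W => by
    simp
  refine ⟨fun i => if i ∈ U then 0 else if i ∈ V then 1 else a i, ?_, ?_, ?_⟩
  · intro i
    have := ha i
    dsimp only
    split_ifs <;> omega
  · have key : ones (fun i => if i ∈ U then 0 else if i ∈ V then 1 else a i) + U.card
        = ones a + V.card := by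
      rw [← sumInd U, ← sumInd V, ones, ones, ← Finset.sum_add_distrib, ← Finset.sum_add_distrib]
      refine Finset.sum_congr rfl fun i _ => ?_
      have h1 := hU1 i
      have h2 := hV0 i
      by_cases hu : i ∈ U <;> by_cases hv : i ∈ V <;> simp_all
    omega
  · have key : hamming a (fun i => if i ∈ U then 0 else if i ∈ V then 1 else a i)
        = U.card + V.card := by
      rw [← sumInd U, ← sumInd V, hamming, ← Finset.sum_add_distrib]
      refine Finset.sum_congr rfl fun i _ => ?_
      have h1 := hU1 i
      have h2 := hV0 i
      by_cases hu : i ∈ U <;> by_cases hv : i ∈ V <;> simp_all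
    omega
end

section
/- Let a ∈ {0,1}^n be a binary vector. Call an index i ∈ {0,…,n} balanced if 2·∑_{k=i+1}^n a_k ≤ n − i (the number of ones of a strictly to the right of i is at most the number of zeros strictly to the right of i). If i is balanced and j ∈ {0,…,n} is not balanced, then e(i) ≤ e(j); i.e., every balanced threshold has error no larger than every unbalanced threshold. -/
theorem err_add_ones {n : ℕ} (a : Fin n → ℕ) (ha : isBinary a) (k : ℕ) (hk : k ≤ n) :
    err a k + ones a = k + 2 * suffixSum a k := by
  have hc : ∑ p : Fin n, (if (p : ℕ) < k then 1 else 0) = k := by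
    rw [Fin.sum_univ_eq_sum_range (fun p => if p < k then 1 else 0) n, ← Finset.sum_filter]
    have : (Finset.range n).filter (fun p => p < k) = Finset.range k := by
      ext p
      simp only [Finset.mem_filter, Finset.mem_range]
      omega
    rw [this]
    simp
  unfold err hamming ones suffixSum thresh
  rw [Finset.sum_filter, Finset.mul_sum, ← Finset.sum_add_distrib]
  refine Eq.trans ?_ (congrArg (fun t => t + _) hc)
  rw [← Finset.sum_add_distrib]
  refine Finset.sum_congr rfl fun p _ => ?_
  have := ha p
  split_ifs <;> push_cast <;> omega

/-- Every balanced threshold index has error no larger than every unbalanced one. -/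
theorem stmt6 (n : ℕ) (a : Fin n → ℕ) (ha : isBinary a) (i j : ℕ) (hi : i ≤ n) (hj : j ≤ n)
    (hbi : BalancedIdx a i) (hbj : ¬ BalancedIdx a j) : err a i ≤ err a j := by
  have h1 := err_add_ones a ha i hi
  have h2 := err_add_ones a ha j hj
  unfold BalancedIdx at hbi hbj
  omega
end

section
/- (Optimality of DP-Search.) Let a ∈ {0,1}^n be a binary vector and let c_k = ∑_{j=1}^k (2a_j − 1) for k ∈ {0,…,n} with c_0 = 0. For any index k* maximizing c over {0,…,n}, the threshold vector y^{k*} is a global minimizer of the Hamming distance ‖a − y‖₁ over all ordered (ones-then-zeros) vectors y ∈ {0,1}^n; that is, ‖a − y^{k*}‖₁ ≤ ‖a − y‖₁ for every y ∈ {0,1}^n such that y_j = 1 implies y_{j'} = 1 for all j' ≤ j. -/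
theorem err_eq {n : ℕ} (a : Fin n → ℕ) (ha : isBinary a) (k : ℕ) :
    (err a k : ℤ) = (∑ i, (a i : ℤ)) - signedPrefix a k := by
  unfold err hamming signedPrefix thresh
  rw [Finset.sum_filter, ← Finset.sum_sub_distrib]
  push_cast
  refine Finset.sum_congr rfl fun i _ => ?_
  have h := ha i
  have h2 : a i = 0 ∨ a i = 1 := by omega
  rcases h2 with h2 | h2 <;> by_cases hi : (i : ℕ) < k <;> simp [h2, hi]

theorem exists_thresh {n : ℕ} (y : Fin n → ℕ) (hy : isBinary y) (ho : OnesThenZeros y) :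
    ∃ l ≤ n, y = thresh n l := by
  classical
  have hP : ∃ l, ∀ i : Fin n, l ≤ (i : ℕ) → y i ≠ 1 :=
    ⟨n, fun i hi => absurd i.isLt (by omega)⟩
  refine ⟨Nat.find hP, Nat.find_min' hP fun i hi => absurd i.isLt (by omega), ?_⟩
  funext i
  unfold thresh
  split_ifs with hi
  · have h := Nat.find_min hP hi
    push Not at h
    obtain ⟨j, hj, hyj⟩ := h
    exact ho j i hyj hj
  · have h := Nat.find_spec hP i (by omega)
    have h2 := hy i
    omega

/-- Optimality of DP-Search: if `k*` maximizes the signed prefix sums over `{0,…,n}`, then the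
threshold vector `y^{k*}` minimizes `‖a − y‖₁` over all ordered (ones-then-zeros) vectors. -/
theorem stmt9 (n : ℕ) (a : Fin n → ℕ) (ha : isBinary a) (k : ℕ) (hk : k ≤ n)
    (hmax : ∀ l ≤ n, signedPrefix a l ≤ signedPrefix a k) :
    ∀ y : Fin n → ℕ, isBinary y → OnesThenZeros y → err a k ≤ hamming a y := by
  intro y hy ho
  obtain ⟨l, hl, rfl⟩ := exists_thresh y hy ho
  have h1 := err_eq a ha k
  have h2 := err_eq a ha l
  have h3 := hmax l hl
  change err a k ≤ err a l
  omega
end
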